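/- Let λ be an even nondegenerate symmetric bilinear integral form on a finitely generated free abelian group H (λ(x,x) ∈ 2ℤ for all x), and let q = q_{λ,0} be the induced homogeneous quadratic refinement on T = coker(λ̂). Then 8·A(q) ≡ σ(λ) mod 8, where σ(λ) is the signature of λ. -/

import Mathlib

open Matrix

/-- The exponential character `r ↦ e^{2πir}` on `ℚ`. -/
noncomputable def eQ : ℚ → ℂ := fun r => Complex.exp (2 * Real.pi * Complex.I * (r : ℂ))

theorem eQ_periodic : Function.Periodic eQ 1 := by
  intro r
  simp only [eQ]
  push_cast
  rw [mul_add, mul_one, Complex.exp_add, Complex.exp_two_pi_mul_I, mul_one]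

/-- The induced character `e^{2πi ·} : ℚ/ℤ → ℂ`. -/
noncomputable def eQZ : AddCircle (1 : ℚ) → ℂ := eQ_periodic.lift

/-- A `ℤ`-vector viewed as a `ℚ`-vector. -/
def ratVec {m : ℕ} (v : Fin m → ℤ) : Fin m → ℚ := fun i => (v i : ℚ)

/-- The rational inverse form `λ⁻¹(x,y) = x ⬝ A⁻¹ y` of an integral form `A`. -/
noncomputable def linv {m : ℕ} (A : Matrix (Fin m) (Fin m) ℤ) (x y : Fin m → ℚ) : ℚ :=
  x ⬝ᵥ (A.map ((↑) : ℤ → ℚ))⁻¹.mulVec y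

lemma theta_summable (z : ℂ) (hz : 0 < z.re) :
    Summable (fun n : ℤ => Complex.exp (-Real.pi * z * (n:ℂ)^2)) := by
  have := (summable_jacobiTheta₂_term_iff 0 (Complex.I * z)).2 (by simpa using hz)
  refine this.congr ?_
  intro n
  rw [jacobiTheta₂_term]
  congr 1
  linear_combination (Real.pi * z * (n:ℂ)^2) * Complex.I_mul_I

open Filter Topology in
lemma theta_tendsto {α : Type*} {l : Filter α} (z : α → ℂ) (hz : Tendsto (fun x => (z x).re) l atTop)
    (θ : ℝ) : Tendsto (fun x => ∑' n : ℤ, Complex.exp (-Real.pi * z x * (n:ℂ)^2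
      + 2 * Real.pi * (θ * Complex.I) * n)) l (𝓝 1) := by
  have key : ∑' n : ℤ, (if n = 0 then (1:ℂ) else 0) = 1 := by simp
  rw [← key]
  have hnorm : ∀ x (n : ℤ), ‖Complex.exp (-Real.pi * z x * (n:ℂ)^2
      + 2 * Real.pi * (θ * Complex.I) * n)‖ = Real.exp (-Real.pi * (z x).re * (n:ℝ)^2) := by
    intro x n
    rw [Complex.norm_exp]
    congr 1
    have : ((n:ℂ)^2) = (((n:ℝ)^2 : ℝ) : ℂ) := by push_cast; rfl
    rw [this]
    simp [Complex.mul_re, Complex.mul_im, -Complex.ofReal_pow]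
  refine tendsto_tsum_of_dominated_convergence (bound := fun n : ℤ => Real.exp (-Real.pi * 1 * (n:ℝ)^2)) ?_ ?_ ?_
  · have := theta_summable 1 (by simp)
    refine this.norm.congr ?_
    intro n
    rw [Complex.norm_exp]
    congr 1
    have : ((n:ℂ)^2) = (((n:ℝ)^2 : ℝ) : ℂ) := by push_cast; rfl
    rw [this]
    simp [Complex.mul_re, Complex.mul_im, -Complex.ofReal_pow]
  · intro n
    by_cases hn : n = 0
    · subst hn; simp [tendsto_const_nhds]
    · simp only [hn, if_false]
      rw [tendsto_zero_iff_norm_tendsto_zero]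
      simp only [hnorm]
      refine Real.tendsto_exp_atBot.comp ?_
      have hp : 0 < Real.pi * (n:ℝ)^2 := by positivity
      have := (hz.const_mul_atTop hp)
      have h2 := tendsto_neg_atTop_atBot.comp this
      refine h2.congr ?_
      intro x; simp; ring
  · filter_upwards [hz.eventually_ge_atTop 1] with x hx n
    rw [hnorm]
    apply Real.exp_le_exp.2
    have hp : 0 ≤ Real.pi * (n:ℝ)^2 := by positivity
    nlinarith

lemma sq_scale (ε : ℝ) (hε : 0 < ε) (w : ℂ) (hw : w ≠ 0) :
    ((ε:ℂ) * w) ^ (1/2:ℂ) = (ε:ℂ)^(1/2:ℂ) * w^(1/2:ℂ) := by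
  have h1 : (ε:ℂ) ≠ 0 := by exact_mod_cast hε.ne'
  rw [Complex.cpow_def_of_ne_zero (mul_ne_zero h1 hw), Complex.cpow_def_of_ne_zero h1,
    Complex.cpow_def_of_ne_zero hw, Complex.log_ofReal_mul hε hw, ← Complex.exp_add, Complex.ofReal_log hε.le]
  ring_nf

open Filter Topology in
lemma gauss_one (d : ℤ) (hd : 0 < d) (heven : Even d) (N : ℕ) [NeZero N] (hN : d ∣ (N:ℤ)) :
    ∃ c : ℝ, 0 ≤ c ∧ ∑ r : Fin N, Complex.exp (Real.pi * Complex.I * (r:ℕ)^2 / d)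
      = c * Complex.exp (2 * Real.pi * Complex.I * (1/8)) := by
  have hdR : (0:ℝ) < d := by exact_mod_cast hd
  have hdC : (d:ℂ) ≠ 0 := by exact_mod_cast hd.ne'
  have hNC : (N:ℂ) ≠ 0 := by exact_mod_cast NeZero.ne N
  have hNR : (0:ℝ) < N := by exact_mod_cast Nat.pos_of_ne_zero (NeZero.ne N)
  set S : ℝ → ℂ := fun ε => ∑' n : ℤ, Complex.exp (-Real.pi * (ε - Complex.I / d) * (n:ℂ)^2) with hS
  set G : ℂ := ∑ r : Fin N, Complex.exp (Real.pi * Complex.I * (r:ℕ)^2 / d) with hG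
  have hre : ∀ ε : ℝ, ((ε:ℂ) - Complex.I / d).re = ε := by
    intro ε; simp [Complex.div_re]
  -- first evaluation
  have h1 : Tendsto (fun ε : ℝ => (ε:ℂ)^(1/2:ℂ) * S ε) (𝓝[>] 0) (𝓝 (1/N * G)) := by
    have e1 : ∀ ε : ℝ, 0 < ε → (ε:ℂ)^(1/2:ℂ) * S ε = ∑ r : Fin N,
        Complex.exp (Real.pi * Complex.I * (r:ℕ)^2 / d) * (1/N * ∑' n : ℤ, Complex.exp (-Real.pi *
          ((1 / (N^2 * ε) : ℝ) : ℂ) * (n:ℂ)^2 + 2 * Real.pi * ((-((r:ℕ)/N) : ℝ) * Complex.I) * n)) := by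
      intro ε hε
      have hεC : (ε:ℂ) ≠ 0 := by exact_mod_cast hε.ne'
      have hsum := theta_summable ((ε:ℂ) - Complex.I / d) (by rw [hre]; exact hε)
      have e2 : S ε = ∑ r : Fin N, ∑' k : ℤ, Complex.exp (-Real.pi * (ε - Complex.I / d) * ((k * N + (r:ℕ) : ℤ):ℂ)^2) := by
        simp only [hS]
        rw [← (Int.divModEquiv N).symm.tsum_eq, ← (Equiv.prodComm _ _).tsum_eq]
        rw [Summable.tsum_prod]
        · rw [tsum_fintype]
          simp
        · have := ((Equiv.prodComm _ _).trans (Int.divModEquiv N).symm).summable_iff.2 hsum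
          exact this
      rw [e2, Finset.mul_sum]
      refine Finset.sum_congr rfl fun r _ => ?_
      have hpos : 0 < (((1 / (N^2 * ε) : ℝ) : ℂ)).re := by
        rw [Complex.ofReal_re]; positivity
      rw [Complex.tsum_exp_neg_quadratic hpos]
      have e3 : ∀ k : ℤ, Complex.exp (-Real.pi * (ε - Complex.I / d) * ((k * N + (r:ℕ) : ℤ):ℂ)^2)
          = Complex.exp (Real.pi * Complex.I * (r:ℕ)^2 / d) *
            Complex.exp (-Real.pi / ((1 / (N^2 * ε) : ℝ) : ℂ) * (k + Complex.I * ((-((r:ℕ)/N) : ℝ) * Complex.I))^2) := by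
        intro k
        obtain ⟨t, ht⟩ := hN
        obtain ⟨a, ha⟩ := heven
        have hNt : (N:ℂ) = d * t := by exact_mod_cast ht
        have hda : (d:ℂ) = a + a := by exact_mod_cast ha
        rw [← Complex.exp_add, Complex.exp_eq_exp_iff_exists_int]
        refine ⟨a * t^2 * k^2 + k * t * r, ?_⟩
        have hI : Complex.I * ((-((r:ℕ)/N) : ℝ) * Complex.I) = (r:ℕ) / N := by
          push_cast
          linear_combination (-((r:ℕ)/N:ℂ)) * Complex.I_mul_I
        rw [hI]
        have htC : (t:ℂ) ≠ 0 := by rintro h; rw [h, mul_zero] at hNt; exact hNC hNt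
        push_cast
        have ha2 : (a:ℂ) = d / 2 := by rw [hda]; ring
        rw [hNt, ha2]
        field_simp
        ring
      simp_rw [e3]
      rw [tsum_mul_left]
      have e4 : 1 / ((1 / (N^2 * ε) : ℝ) : ℂ)^(1/2:ℂ) = N * (ε:ℂ)^(1/2:ℂ) := by
        have a1 : ((1 / (N^2 * ε) : ℝ) : ℂ) = (((N:ℝ)^2 * ε : ℝ) : ℂ)⁻¹ := by push_cast; simp
        have a2 : (0:ℝ) ≤ (N:ℝ)^2 * ε := by positivity
        have e12 : (1/2 : ℂ) = ((1/2 : ℝ) : ℂ) := by push_cast; rfl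
        rw [e12, ← Complex.ofReal_cpow (by positivity), ← Complex.ofReal_cpow hε.le,
          ← Real.sqrt_eq_rpow, ← Real.sqrt_eq_rpow, one_div (((N:ℝ))^2 * ε), Real.sqrt_inv,
          Real.sqrt_mul (by positivity), Real.sqrt_sq hNR.le]
        push_cast
        simp
      rw [e4]
      field_simp
    have e5 : Tendsto (fun ε : ℝ => ∑ r : Fin N,
        Complex.exp (Real.pi * Complex.I * (r:ℕ)^2 / d) * (1/N * ∑' n : ℤ, Complex.exp (-Real.pi *
          ((1 / (N^2 * ε) : ℝ) : ℂ) * (n:ℂ)^2 + 2 * Real.pi * ((-((r:ℕ)/N) : ℝ) * Complex.I) * n))) (𝓝[>] 0)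
        (𝓝 (∑ r : Fin N, Complex.exp (Real.pi * Complex.I * (r:ℕ)^2 / d) * (1/N * 1))) := by
      refine tendsto_finsetSum _ fun r _ => ?_
      refine Tendsto.const_mul _ (Tendsto.const_mul _ ?_)
      apply theta_tendsto
      simp only [Complex.ofReal_re]
      have := (tendsto_inv_nhdsGT_zero (𝕜 := ℝ)).const_mul_atTop (show 0 < 1/(N:ℝ)^2 by positivity)
      refine this.congr ?_
      intro x
      rw [one_div, one_div, mul_inv]
    have e6 : 1/N * G = (∑ r : Fin N, Complex.exp (Real.pi * Complex.I * (r:ℕ)^2 / d) * (1/N * 1)) := by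
      rw [hG, Finset.mul_sum]
      refine Finset.sum_congr rfl fun r _ => by ring
    rw [e6]
    refine e5.congr' ?_
    filter_upwards [self_mem_nhdsWithin] with ε hε
    exact (e1 ε hε).symm
  -- second evaluation
  have h2 : Tendsto (fun ε : ℝ => (ε:ℂ)^(1/2:ℂ) * S ε) (𝓝[>] 0)
      (𝓝 (1 / (-Complex.I / d)^(1/2:ℂ) * (1 / ((d:ℂ)^2)^(1/2:ℂ)) * 1)) := by
    have hden : ∀ ε : ℝ, (1 + d * ε * Complex.I : ℂ) ≠ 0 := by
      intro ε h
      have := congrArg Complex.re h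
      simp at this
    have e1 : ∀ ε : ℝ, 0 < ε → (ε:ℂ)^(1/2:ℂ) * S ε = 1 / (ε - Complex.I / d)^(1/2:ℂ) *
        (1 / ((d:ℂ)^2 / (1 + d * ε * Complex.I))^(1/2:ℂ)) *
        ∑' n : ℤ, Complex.exp (-Real.pi * (1 / (d^2 * ε) + Complex.I / d) * (n:ℂ)^2 +
          2 * Real.pi * ((0:ℝ) * Complex.I) * n) := by
      intro ε hε
      have hεC : (ε:ℂ) ≠ 0 := by exact_mod_cast hε.ne'
      have hz : (ε:ℂ) - Complex.I / d ≠ 0 := by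
        intro h; have := hre ε; rw [h] at this; simp at this; linarith
      simp only [hS]
      rw [Complex.tsum_exp_neg_mul_int_sq (by rw [hre]; exact hε)]
      set δ : ℂ := ε * ((d:ℂ)^2 / (1 + d * ε * Complex.I)) with hδ
      have hδ0 : δ ≠ 0 := mul_ne_zero hεC (div_ne_zero (pow_ne_zero _ hdC) (hden ε))
      have hδinv : 1 / δ = 1 / (d^2 * ε) + Complex.I / d := by
        rw [hδ]
        have := hden ε
        field_simp
      have hδre : 0 < δ.re := by
        have : 0 < (δ⁻¹).re := by
          rw [← one_div, hδinv]
          have : (1 / ((d:ℂ)^2 * ε) + Complex.I / d) = ((1 / (d^2*ε) : ℝ):ℂ) + ((1/d:ℝ):ℂ) * Complex.I := by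
            push_cast; ring
          rw [this, Complex.add_re, Complex.ofReal_re, Complex.re_ofReal_mul, Complex.I_re, mul_zero, add_zero]
          positivity
        rw [Complex.inv_re] at this
        have hns : 0 < Complex.normSq δ := Complex.normSq_pos.2 hδ0
        exact (div_pos_iff_of_pos_right hns).1 this
      have hshift : ∀ n : ℤ, Complex.exp (-Real.pi / (ε - Complex.I / d) * (n:ℂ)^2) = Complex.exp (-Real.pi * δ * (n:ℂ)^2) := by
        intro n
        obtain ⟨a, ha⟩ := heven
        have hda : (d:ℂ) = a + a := by exact_mod_cast ha
        have ha2 : (a:ℂ) = d / 2 := by rw [hda]; ring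
        rw [Complex.exp_eq_exp_iff_exists_int]
        refine ⟨-a * n^2, ?_⟩
        have hinv : 1 / ((ε:ℂ) - Complex.I / d) = δ + d * Complex.I := by
          have h5 : δ * (1 + d * ε * Complex.I) = ε * d^2 := by
            rw [hδ, mul_assoc, div_mul_cancel₀ _ (hden ε)]
          have h6 : (ε:ℂ) - Complex.I / d = -Complex.I / d * (1 + d * ε * Complex.I) := by
            field_simp
            linear_combination (d * ε : ℂ) * Complex.I_mul_I
          rw [div_eq_iff hz, h6]
          have h7 : (δ + d * Complex.I) * (-Complex.I / d * (1 + d * ε * Complex.I))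
             = -Complex.I / d * (δ * (1 + d * ε * Complex.I)) - Complex.I * Complex.I * (1 + d * ε * Complex.I) := by
            field_simp
            ring
          rw [h7, h5, Complex.I_mul_I]
          field_simp
          ring
        have : -(Real.pi:ℂ) / (ε - Complex.I / d) = -Real.pi * (1 / (ε - Complex.I / d)) := by ring
        rw [this, hinv]
        push_cast
        rw [ha2]
        ring
      simp_rw [hshift]
      rw [Complex.tsum_exp_neg_mul_int_sq hδre]
      have hsc : δ^(1/2:ℂ) = (ε:ℂ)^(1/2:ℂ) * ((d:ℂ)^2 / (1 + d * ε * Complex.I))^(1/2:ℂ) :=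
        sq_scale ε hε _ (div_ne_zero (pow_ne_zero _ hdC) (hden ε))
      rw [hsc, ← hδinv]
      have hε2 : (ε:ℂ)^(1/2:ℂ) ≠ 0 := by
        rw [Complex.cpow_def_of_ne_zero hεC]; exact Complex.exp_ne_zero _
      have : ∀ n : ℤ, Complex.exp (-Real.pi * (1 / δ) * (n:ℂ)^2 +
          2 * Real.pi * ((0:ℝ) * Complex.I) * n) = Complex.exp (-Real.pi / δ * (n:ℂ)^2) := by
        intro n; congr 1; push_cast; ring
      simp_rw [this]
      rw [one_div_mul_one_div_rev, ← mul_assoc, ← mul_assoc]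
      congr 1
      field_simp
    have e2 : Tendsto (fun ε : ℝ => 1 / ((ε:ℂ) - Complex.I / d)^(1/2:ℂ) *
        (1 / ((d:ℂ)^2 / (1 + d * ε * Complex.I))^(1/2:ℂ)) *
        ∑' n : ℤ, Complex.exp (-Real.pi * (1 / (d^2 * ε) + Complex.I / d) * (n:ℂ)^2 +
          2 * Real.pi * ((0:ℝ) * Complex.I) * n)) (𝓝[>] 0)
      (𝓝 (1 / (-Complex.I / d)^(1/2:ℂ) * (1 / ((d:ℂ)^2)^(1/2:ℂ)) * 1)) := by
      refine Tendsto.mul (Tendsto.mul ?_ ?_) ?_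
      · have hs : (((0:ℝ):ℂ) - Complex.I / d) ∈ Complex.slitPlane := by
          rw [Complex.mem_slitPlane_iff]; right
          have : Complex.I / (d:ℂ) = ((1/d:ℝ):ℂ) * Complex.I := by push_cast; ring
          rw [this]; simp; exact hd.ne'
        have hc : ContinuousAt (fun ε : ℝ => 1 / ((ε:ℂ) - Complex.I / d)^(1/2:ℂ)) 0 := by
          refine ContinuousAt.div continuousAt_const (ContinuousAt.cpow (by fun_prop) continuousAt_const hs) ?_
          rw [Complex.cpow_def_of_ne_zero (Complex.slitPlane_ne_zero hs)]; exact Complex.exp_ne_zero _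
        have := hc.tendsto.mono_left (nhdsWithin_le_nhds (s := Set.Ioi 0))
        simpa [neg_div] using this
      · have hs : ((d:ℂ)^2 / (1 + d * ((0:ℝ):ℂ) * Complex.I)) ∈ Complex.slitPlane := by
          rw [Complex.mem_slitPlane_iff]; left
          have : ((d:ℂ)^2 / (1 + d * ((0:ℝ):ℂ) * Complex.I)) = ((d^2:ℝ):ℂ) := by push_cast; simp
          rw [this, Complex.ofReal_re]; positivity
        have hc : ContinuousAt (fun ε : ℝ => 1 / ((d:ℂ)^2 / (1 + d * ε * Complex.I))^(1/2:ℂ)) 0 := by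
          refine ContinuousAt.div continuousAt_const (ContinuousAt.cpow (ContinuousAt.div (by fun_prop) (by fun_prop) (hden 0)) continuousAt_const hs) ?_
          rw [Complex.cpow_def_of_ne_zero (Complex.slitPlane_ne_zero hs)]; exact Complex.exp_ne_zero _
        have := hc.tendsto.mono_left (nhdsWithin_le_nhds (s := Set.Ioi 0))
        simpa using this
      · apply theta_tendsto
        have := (tendsto_inv_nhdsGT_zero (𝕜 := ℝ)).const_mul_atTop (show 0 < 1/(d:ℝ)^2 by positivity)
        refine this.congr ?_
        intro ε
        have : (1 / ((d:ℂ)^2 * ε) + Complex.I / d) = ((1 / (d^2*ε) : ℝ):ℂ) + ((1/d:ℝ):ℂ) * Complex.I := by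
            push_cast; ring
        rw [this, Complex.add_re, Complex.ofReal_re, Complex.re_ofReal_mul, Complex.I_re, mul_zero, add_zero,
          one_div, one_div, mul_inv]
    refine e2.congr' ?_
    filter_upwards [self_mem_nhdsWithin] with ε hε
    exact (e1 ε hε).symm
  have h3 := tendsto_nhds_unique h1 h2
  have e12 : (1/2 : ℂ) = ((1/2 : ℝ) : ℂ) := by push_cast; rfl
  have hdd : ((d:ℂ)^2)^(1/2:ℂ) = d := by
    have : (d:ℂ)^2 = (((d:ℝ)^2 : ℝ):ℂ) := by push_cast; rfl
    rw [this, e12, ← Complex.ofReal_cpow (by positivity), ← Real.sqrt_eq_rpow, Real.sqrt_sq hdR.le]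
    simp
  have hI : (-Complex.I / d)^(1/2:ℂ) = (((1/d : ℝ)^(1/2:ℝ) : ℝ) : ℂ) * Complex.exp (-(2 * Real.pi * Complex.I * (1/8))) := by
    have : (-Complex.I / d : ℂ) = ((1/d : ℝ):ℂ) * (-Complex.I) := by push_cast; ring
    rw [this, sq_scale _ (by positivity) _ (by simp), Complex.ofReal_cpow (by positivity)]
    congr 1
    · push_cast; rfl
    · rw [Complex.cpow_def_of_ne_zero (by simp), Complex.log_neg_I]
      congr 1; ring
  rw [hdd, hI] at h3
  refine ⟨N * (1 / (1/d : ℝ)^(1/2:ℝ)) * (1/d), by positivity, ?_⟩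
  have h4 : G = N * (1/N * G) := by field_simp
  rw [h4, h3, Complex.exp_neg]
  push_cast
  have := Complex.exp_ne_zero (2 * Real.pi * Complex.I * (1/8))
  field_simp

open QuadraticMap in
lemma equiv_wss {m : ℕ} (A P : Matrix (Fin m) (Fin m) ℝ) (d : Fin m → ℝ) (hP : IsUnit P.det)
    (h : P * A * P.transpose = Matrix.diagonal d) :
    (Matrix.toQuadraticForm' A).Equivalent (QuadraticMap.weightedSumSquares ℝ d) := by
  apply QuadraticMap.Equivalent.symm
  have hPt : IsUnit P.transpose := by
    rw [Matrix.isUnit_iff_isUnit_det, Matrix.det_transpose]; exact hP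
  let _ := hPt.invertible
  refine ⟨⟨P.transpose.toLinearEquiv' hPt.invertible, ?_⟩⟩
  intro v
  rw [QuadraticMap.weightedSumSquares_apply]
  change A.toQuadraticForm' (Matrix.toLin' P.transpose v) = _
  have : A.toQuadraticForm' (Matrix.toLin' P.transpose v) = v ⬝ᵥ (Matrix.diagonal d).mulVec v := by
    rw [← h, Matrix.toQuadraticForm', LinearMap.BilinMap.toQuadraticMap_apply,
      Matrix.toLinearMap₂'_apply', Matrix.toLin'_apply, ← Matrix.mulVec_mulVec, ← Matrix.mulVec_mulVec,
      Matrix.dotProduct_mulVec v, Matrix.mulVec_transpose]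
  rw [this]
  simp only [dotProduct, Matrix.mulVec_diagonal, smul_eq_mul]
  refine Finset.sum_congr rfl fun i _ => by ring

lemma inertia {m : ℕ} (A P P' : Matrix (Fin m) (Fin m) ℝ) (d d' : Fin m → ℝ) (hP : IsUnit P.det)
    (hP' : IsUnit P'.det)
    (h : P * A * P.transpose = Matrix.diagonal d) (h' : P' * A * P'.transpose = Matrix.diagonal d') :
    ((Finset.univ.filter fun i => 0 < d i).card : ℤ) -
            ((Finset.univ.filter fun i => d i < 0).card : ℤ)
    = ((Finset.univ.filter fun i => 0 < d' i).card : ℤ) -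
            ((Finset.univ.filter fun i => d' i < 0).card : ℤ) := by
  have e := equiv_wss A P d hP h
  have e' := equiv_wss A P' d' hP' h'
  have h1 := QuadraticForm.sigPos_of_equiv_weightedSumSquares e
  have h2 := QuadraticForm.sigNeg_of_equiv_weightedSumSquares e
  have h3 := QuadraticForm.sigPos_of_equiv_weightedSumSquares e'
  have h4 := QuadraticForm.sigNeg_of_equiv_weightedSumSquares e'
  have key : ∀ p : Fin m → Prop, ∀ [DecidablePred p], {i | p i}.ncard = (Finset.univ.filter p).card := by
    intro p _
    rw [← Set.ncard_coe_finset]; simp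
  rw [key] at h1 h2 h3 h4
  rw [← h1, ← h2, ← h3, ← h4]

lemma exists_diag {m : ℕ} (A : Matrix (Fin m) (Fin m) ℤ) (hsymm : A.IsSymm) :
    ∃ (B : Matrix (Fin m) (Fin m) ℤ) (e : Fin m → ℤ), B.det ≠ 0 ∧ B.transpose * A * B = Matrix.diagonal e := by
  set AQ : Matrix (Fin m) (Fin m) ℚ := A.map ((↑) : ℤ → ℚ) with hAQ
  have hs : LinearMap.IsSymm (Matrix.toBilin' AQ) := by
    constructor
    intro x y
    simp only [Matrix.toBilin'_apply', RingHom.id_apply]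
    have : AQ.transpose = AQ := by
      rw [hAQ, ← Matrix.transpose_map, hsymm.eq]
    rw [Matrix.dotProduct_mulVec, ← Matrix.mulVec_transpose, this, dotProduct_comm]
  have : Invertible (2:ℚ) := invertibleOfNonzero (by norm_num)
  obtain ⟨v0, hv0⟩ := LinearMap.BilinForm.exists_orthogonal_basis hs
  have hfr : Module.finrank ℚ (Fin m → ℚ) = m := by simp
  set v := v0.reindex (finCongr hfr) with hv
  have hv' : ∀ i j, i ≠ j → v i ⬝ᵥ AQ.mulVec (v j) = 0 := by
    intro i j hij
    have := hv0 (i := (finCongr hfr).symm i) (j := (finCongr hfr).symm j) (by simpa using hij)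
    simpa [Matrix.toBilin'_apply', Function.onFun, hv] using this
  obtain ⟨D, hD⟩ := IsLocalization.exist_integer_multiples_of_finite (nonZeroDivisors ℤ)
    (fun p : Fin m × Fin m => v p.2 p.1)
  choose B0 hB0 using hD
  have hD0 : ((D:ℤ):ℚ) ≠ 0 := by exact_mod_cast nonZeroDivisors.coe_ne_zero D
  set B : Matrix (Fin m) (Fin m) ℤ := fun i j => B0 (i, j) with hB
  have hBQ : ∀ i j, (B i j : ℚ) = (D:ℤ) * v j i := by
    intro i j
    have := hB0 (i, j)
    simpa [Submonoid.smul_def] using this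
  refine ⟨B, fun i => (B.transpose * A * B) i i, ?_, ?_⟩
  · have h1 : B.map ((↑) : ℤ → ℚ) = ((D:ℤ):ℚ) • ((Pi.basisFun ℚ (Fin m)).toMatrix v) := by
      ext i j
      simp [hBQ, Module.Basis.toMatrix_apply]
    have h2 : ((Pi.basisFun ℚ (Fin m)).toMatrix v).det ≠ 0 := by
      have := (Pi.basisFun ℚ (Fin m)).isUnit_det v
      rw [Module.Basis.det_apply] at this
      exact this.ne_zero
    have h3 : (B.map ((↑) : ℤ → ℚ)).det = (B.det : ℚ) := by
      exact ((Int.castRingHom ℚ).map_det B).symm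
    have h4 : (B.det : ℚ) ≠ 0 := by
      rw [← h3, h1, Matrix.det_smul]
      exact mul_ne_zero (pow_ne_zero _ hD0) h2
    exact_mod_cast h4
  · ext i j
    by_cases hij : i = j
    · subst hij; simp
    · rw [Matrix.diagonal_apply_ne _ hij]
      have : (((B.transpose * A * B) i j : ℤ) : ℚ) = (D:ℤ) * (D:ℤ) * (v i ⬝ᵥ AQ.mulVec (v j)) := by
        rw [Matrix.mul_assoc, Matrix.mul_apply, dotProduct, Finset.mul_sum]
        push_cast
        refine Finset.sum_congr rfl fun k _ => ?_
        rw [Matrix.transpose_apply, hBQ, Matrix.mul_apply, Matrix.mulVec, dotProduct]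
        push_cast
        rw [Finset.mul_sum, Finset.mul_sum, Finset.mul_sum]
        refine Finset.sum_congr rfl fun l _ => ?_
        rw [hBQ, hAQ, Matrix.map_apply]; ring
      rw [hv' i j hij, mul_zero] at this
      exact_mod_cast this

lemma eQ_add (r s : ℚ) : eQ (r + s) = eQ r * eQ s := by
  simp only [eQ]; rw [← Complex.exp_add]; congr 1; push_cast; ring

lemma eQ_int (n : ℤ) : eQ n = 1 := by
  simp only [eQ]
  rw [Complex.exp_eq_one_iff]
  exact ⟨n, by push_cast; ring⟩

lemma eQ_zero : eQ 0 = 1 := by simpa using eQ_int 0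

lemma eQ_sum {ι : Type*} (s : Finset ι) (f : ι → ℚ) : eQ (∑ i ∈ s, f i) = ∏ i ∈ s, eQ (f i) := by
  classical
  induction s using Finset.induction_on with
  | empty => simp [eQ_zero]
  | insert a s ha ih => rw [Finset.sum_insert ha, Finset.prod_insert ha, eQ_add, ih]

lemma eQ_eq_one {r : ℚ} (h : eQ r = 1) : ∃ n : ℤ, r = n := by
  simp only [eQ] at h
  rw [Complex.exp_eq_one_iff] at h
  obtain ⟨n, hn⟩ := h
  refine ⟨n, ?_⟩
  have h2 : (2 * Real.pi * Complex.I : ℂ) ≠ 0 := Complex.two_pi_I_ne_zero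
  have : (2 * Real.pi * Complex.I : ℂ) * (r:ℂ) = (2 * Real.pi * Complex.I : ℂ) * (n:ℂ) := by rw [hn]; ring
  have := mul_left_cancel₀ h2 this
  exact_mod_cast this

lemma eQ_conj (r : ℚ) : (starRingEnd ℂ) (eQ r) = eQ (-r) := by
  simp only [eQ]
  rw [← Complex.exp_conj]
  congr 1
  have h2 : (starRingEnd ℂ) 2 = 2 := Complex.conj_ofReal 2
  have h3 : (starRingEnd ℂ) (r:ℂ) = (r:ℂ) := by
    have : (r:ℂ) = ((r:ℝ):ℂ) := by push_cast; rfl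
    rw [this, Complex.conj_ofReal]
  simp only [map_mul, Complex.conj_ofReal, Complex.conj_I, h2, h3]
  push_cast
  ring

lemma eQ_norm (r : ℚ) : ‖eQ r‖ = 1 := by
  simp only [eQ]
  have : (2 * Real.pi * Complex.I * (r : ℂ)) = ((2 * Real.pi * r : ℝ) : ℂ) * Complex.I := by push_cast; ring
  rw [this, Complex.norm_exp_ofReal_mul_I]

lemma eQZ_coe (r : ℚ) : eQZ (r : AddCircle (1:ℚ)) = eQ r := rfl

lemma eQ_ray {r s : ℚ} {c : ℝ} {c' : ℝ} (hc : 0 < c) (hc' : 0 ≤ c') (h : c * eQ r = c' * eQ s) :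
    (r : AddCircle (1:ℚ)) = (s : AddCircle (1:ℚ)) := by
  have hn := congrArg norm h
  rw [norm_mul, norm_mul, eQ_norm, eQ_norm, mul_one, mul_one, Complex.norm_real, Complex.norm_real,
    Real.norm_of_nonneg hc.le, Real.norm_of_nonneg hc'] at hn
  subst hn
  have hcC : (c:ℂ) ≠ 0 := by exact_mod_cast hc.ne'
  have h1 := mul_left_cancel₀ hcC h
  have h2 : eQ (r - s) = 1 := by
    rw [sub_eq_add_neg, eQ_add, h1, ← eQ_add, add_neg_cancel, eQ_zero]
  obtain ⟨n, hn⟩ := eQ_eq_one h2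
  rw [← sub_eq_zero, ← AddCircle.coe_sub, hn, AddCircle.coe_eq_zero_iff]
  exact ⟨n, by simp⟩

/-! ### linear algebra -/

lemma ratVec_add {m : ℕ} (x y : Fin m → ℤ) : ratVec (x + y) = ratVec x + ratVec y := by
  ext i; simp [ratVec]

lemma ratVec_smul {m : ℕ} (n : ℤ) (x : Fin m → ℤ) : ratVec (n • x) = (n:ℚ) • ratVec x := by
  ext i; simp [ratVec]

lemma ratVec_mulVec {m : ℕ} (A : Matrix (Fin m) (Fin m) ℤ) (x : Fin m → ℤ) :
    ratVec (A.mulVec x) = (A.map ((↑) : ℤ → ℚ)).mulVec (ratVec x) := by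
  ext i; simp [ratVec, Matrix.mulVec, dotProduct]

lemma ratVec_dot {m : ℕ} (x y : Fin m → ℤ) : ratVec x ⬝ᵥ ratVec y = ((x ⬝ᵥ y : ℤ) : ℚ) := by
  simp [ratVec, dotProduct]

lemma mapQ_det {m : ℕ} (A : Matrix (Fin m) (Fin m) ℤ) :
    (A.map ((↑) : ℤ → ℚ)).det = (A.det : ℚ) := ((Int.castRingHom ℚ).map_det A).symm

lemma mapQ_mul {m : ℕ} (A B : Matrix (Fin m) (Fin m) ℤ) :
    (A * B).map ((↑) : ℤ → ℚ) = A.map ((↑) : ℤ → ℚ) * B.map ((↑) : ℤ → ℚ) :=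
  Matrix.map_mul (f := Int.castRingHom ℚ)

lemma mapQ_unit {m : ℕ} (A : Matrix (Fin m) (Fin m) ℤ) (h : A.det ≠ 0) :
    IsUnit (A.map ((↑) : ℤ → ℚ)).det := by
  rw [mapQ_det, isUnit_iff_ne_zero]; exact_mod_cast h

lemma exists_pre {m : ℕ} (A : Matrix (Fin m) (Fin m) ℤ) (N : ℤ) (h : A.det ∣ N) (y : Fin m → ℤ) :
    ∃ z, N • y = A.mulVec z := by
  obtain ⟨t, rfl⟩ := h
  refine ⟨t • A.adjugate.mulVec y, ?_⟩
  rw [Matrix.mulVec_smul, Matrix.mulVec_mulVec, Matrix.mul_adjugate, Matrix.smul_mulVec, Matrix.one_mulVec,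
    smul_smul, mul_comm]

/-- the character value attached to the discriminant form -/
noncomputable def Gq {m : ℕ} (A : Matrix (Fin m) (Fin m) ℤ) (φ : Fin m → ℤ) : ℂ :=
  eQ (linv A (ratVec φ) (ratVec φ) / 2)

noncomputable def Xc {m : ℕ} (B : Matrix (Fin m) (Fin m) ℤ) (ψ x : Fin m → ℤ) : ℂ :=
  eQ (linv B (ratVec ψ) (ratVec x))

lemma Gq_shift {m : ℕ} (A B : Matrix (Fin m) (Fin m) ℤ) (hsymm : A.IsSymm) (hdet : A.det ≠ 0)
    (hB : B.det ≠ 0) (heven : ∀ x : Fin m → ℤ, ∃ c : ℤ, x ⬝ᵥ A.mulVec x = 2 * c) (ψ x : Fin m → ℤ) :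
    Gq (B.transpose * A * B) (ψ + (B.transpose * A).mulVec x) = Gq (B.transpose * A * B) ψ * Xc B ψ x := by
  obtain ⟨c, hc⟩ := heven x
  rw [Gq, Gq, Xc, ← eQ_add, ← mul_one (eQ (_ + _)), ← eQ_int c, ← eQ_add]
  congr 1
  have hc' : ratVec x ⬝ᵥ (A.map ((↑) : ℤ → ℚ)).mulVec (ratVec x) = 2 * c := by
    rw [← ratVec_mulVec, ratVec_dot, hc]; push_cast; ring
  rw [linv, linv, linv, ratVec_add, ratVec_mulVec]
  simp only [mapQ_mul]
  have htr : B.transpose.map ((↑) : ℤ → ℚ) = (B.map ((↑) : ℤ → ℚ)).transpose := rfl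
  have hAs : (A.map ((↑) : ℤ → ℚ)).transpose = A.map ((↑) : ℤ → ℚ) := by
    rw [← Matrix.transpose_map, hsymm.eq]
  have hAu := mapQ_unit A hdet
  have hBu := mapQ_unit B hB
  rw [htr]
  generalize A.map ((↑) : ℤ → ℚ) = a at *
  generalize B.map ((↑) : ℤ → ℚ) = b at *
  generalize ratVec x = X at *
  generalize ratVec ψ = Y at *
  have hSs : ((b.transpose * a * b)⁻¹).transpose = (b.transpose * a * b)⁻¹ := by
    rw [Matrix.transpose_nonsing_inv]
    congr 1
    simp [Matrix.transpose_mul, hAs, Matrix.mul_assoc]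
  have hSR : (b.transpose * a * b)⁻¹ * (b.transpose * a) = b⁻¹ := by
    have hu : IsUnit (b.transpose * a * b).det := by
      simp only [Matrix.det_mul, Matrix.det_transpose]
      exact (hBu.mul hAu).mul hBu
    symm
    rw [Matrix.inv_eq_left_inv]
    rw [Matrix.mul_assoc, Matrix.nonsing_inv_mul _ hu]
  generalize (b.transpose * a * b)⁻¹ = S at *
  have e1 : (b.transpose * a) *ᵥ X ⬝ᵥ S *ᵥ Y = Y ⬝ᵥ b⁻¹ *ᵥ X := by
    rw [dotProduct_comm, ← hSR, ← Matrix.mulVec_mulVec _ S, Matrix.dotProduct_mulVec Y, ← Matrix.mulVec_transpose S, hSs]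
  have e2 : (b.transpose * a) *ᵥ X ⬝ᵥ b⁻¹ *ᵥ X = X ⬝ᵥ a *ᵥ X := by
    have : (b.transpose * a) *ᵥ X = X ᵥ* (a * b) := by
      rw [← Matrix.mulVec_transpose, Matrix.transpose_mul, hAs]
    rw [this, ← Matrix.dotProduct_mulVec, Matrix.mulVec_mulVec, Matrix.mul_assoc, Matrix.mul_nonsing_inv _ hBu, mul_one]
  rw [Matrix.mulVec_add, add_dotProduct, dotProduct_add, dotProduct_add, e1, Matrix.mulVec_mulVec, hSR, e2, hc']
  ring

lemma Gq_periodic {m : ℕ} (A : Matrix (Fin m) (Fin m) ℤ) (hsymm : A.IsSymm) (hdet : A.det ≠ 0)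
    (heven : ∀ x : Fin m → ℤ, ∃ c : ℤ, x ⬝ᵥ A.mulVec x = 2 * c) (N : ℤ) (hN : A.det ∣ N) (x y : Fin m → ℤ) :
    Gq A (x + N • y) = Gq A x := by
  obtain ⟨z, hz⟩ := exists_pre A N hN y
  have := Gq_shift A 1 hsymm hdet (by simp) heven x z
  simp only [Matrix.transpose_one, Matrix.one_mul, Matrix.mul_one] at this
  rw [hz, this]
  have h1 : Xc 1 x z = 1 := by
    rw [Xc, linv]
    simp [ratVec_dot, eQ_int]
  rw [h1, mul_one]

lemma Gq_pull {m : ℕ} (A B : Matrix (Fin m) (Fin m) ℤ) (hB : B.det ≠ 0) (φ : Fin m → ℤ) :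
    Gq (B.transpose * A * B) (B.transpose.mulVec φ) = Gq A φ := by
  rw [Gq, Gq]
  congr 2
  rw [linv, linv, ratVec_mulVec, mapQ_mul, mapQ_mul]
  have htr : B.transpose.map ((↑) : ℤ → ℚ) = (B.map ((↑) : ℤ → ℚ)).transpose := rfl
  have hBu := mapQ_unit B hB
  rw [htr]
  generalize A.map ((↑) : ℤ → ℚ) = a at *
  generalize B.map ((↑) : ℤ → ℚ) = b at *
  have hbt : IsUnit b.transpose.det := by rwa [Matrix.det_transpose]
  rw [Matrix.mulVec_transpose, ← Matrix.dotProduct_mulVec, ← Matrix.mulVec_transpose, Matrix.mulVec_mulVec, Matrix.mulVec_mulVec,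
    Matrix.mul_inv_rev, Matrix.mul_inv_rev, Matrix.mul_nonsing_inv_cancel_left _ _ hBu,
    Matrix.mul_assoc, Matrix.nonsing_inv_mul _ hbt, Matrix.mul_one]

lemma Xc_add_right {m : ℕ} (B : Matrix (Fin m) (Fin m) ℤ) (ψ x y : Fin m → ℤ) :
    Xc B ψ (x + y) = Xc B ψ x * Xc B ψ y := by
  rw [Xc, Xc, Xc, ← eQ_add, linv, linv, linv, ratVec_add, Matrix.mulVec_add, dotProduct_add]

lemma Xc_add_left {m : ℕ} (B : Matrix (Fin m) (Fin m) ℤ) (ψ ψ' x : Fin m → ℤ) :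
    Xc B (ψ + ψ') x = Xc B ψ x * Xc B ψ' x := by
  rw [Xc, Xc, Xc, ← eQ_add, linv, linv, linv, ratVec_add, add_dotProduct]

lemma Xc_right {m : ℕ} (B : Matrix (Fin m) (Fin m) ℤ) (hB : B.det ≠ 0) (ψ z : Fin m → ℤ) :
    Xc B ψ (B.mulVec z) = 1 := by
  rw [Xc, linv, ratVec_mulVec, Matrix.mulVec_mulVec, Matrix.nonsing_inv_mul _ (mapQ_unit B hB), Matrix.one_mulVec,
    ratVec_dot, eQ_int]

lemma Xc_left {m : ℕ} (B : Matrix (Fin m) (Fin m) ℤ) (hB : B.det ≠ 0) (φ x : Fin m → ℤ) :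
    Xc B (B.transpose.mulVec φ) x = 1 := by
  have htr : B.transpose.map ((↑) : ℤ → ℚ) = (B.map ((↑) : ℤ → ℚ)).transpose := rfl
  rw [Xc, linv, ratVec_mulVec, htr, Matrix.mulVec_transpose, ← Matrix.dotProduct_mulVec, Matrix.mulVec_mulVec,
    Matrix.mul_nonsing_inv _ (mapQ_unit B hB), Matrix.one_mulVec, ratVec_dot, eQ_int]

lemma Xc_trivial {m : ℕ} (B : Matrix (Fin m) (Fin m) ℤ) (hB : B.det ≠ 0) (ψ : Fin m → ℤ)
    (h : ∀ x, Xc B ψ x = 1) : ∃ φ, ψ = B.transpose.mulVec φ := by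
  have h1 : ∀ i, ∃ n : ℤ, (ratVec ψ ᵥ* (B.map ((↑) : ℤ → ℚ))⁻¹) i = n := by
    intro i
    have := eQ_eq_one (h (Pi.single i 1))
    have hr : ratVec (Pi.single i 1 : Fin m → ℤ) = Pi.single i 1 := by
      ext k; by_cases hk : k = i
      · subst hk; simp [ratVec]
      · simp [ratVec, hk]
    rw [linv, hr, Matrix.dotProduct_mulVec, dotProduct_single_one] at this
    exact this
  choose φ hφ using h1
  refine ⟨φ, ?_⟩
  have htr : B.transpose.map ((↑) : ℤ → ℚ) = (B.map ((↑) : ℤ → ℚ)).transpose := rfl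
  have h2 : ratVec ψ = ratVec (B.transpose.mulVec φ) := by
    have : ratVec φ = ratVec ψ ᵥ* (B.map ((↑) : ℤ → ℚ))⁻¹ := by
      ext i; rw [hφ]; rfl
    rw [ratVec_mulVec, this, htr, Matrix.mulVec_transpose, Matrix.vecMul_vecMul, Matrix.nonsing_inv_mul _ (mapQ_unit B hB),
      Matrix.vecMul_one]
  ext i
  have := congrFun h2 i
  simpa [ratVec] using this

/-! ### finite sums -/

lemma sum_hom {K T : Type*} [AddCommGroup K] [Fintype K] [AddCommGroup T] [Fintype T] [DecidableEq T]
    (π : K →+ T) (h : T → ℂ) :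
    ∃ c : ℝ, 0 < c ∧ ∑ k, h (π k) = c * ∑ t ∈ Finset.univ.filter (fun t => t ∈ Set.range π), h t := by
  classical
  refine ⟨((Finset.univ.filter (fun k => π k = 0)).card : ℝ), ?_, ?_⟩
  · have : 0 < (Finset.univ.filter (fun k => π k = 0)).card :=
      Finset.card_pos.2 ⟨0, by simp⟩
    exact_mod_cast this
  · rw [← Finset.sum_fiberwise_of_maps_to (s := Finset.univ)
      (t := Finset.univ.filter (fun t => t ∈ Set.range π)) (g := π) (by intro k _; simp), Finset.mul_sum]
    refine Finset.sum_congr rfl fun t ht => ?_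
    rw [Finset.sum_congr rfl (g := fun _ => h t) (by intro k hk; rw [(Finset.mem_filter.1 hk).2])]
    rw [Finset.sum_const, nsmul_eq_mul]
    have := AddMonoidHom.card_fiber_eq_of_mem_range π (x := t) (y := 0) (Finset.mem_filter.1 ht).2 ⟨0, by simp⟩
    rw [this]; push_cast; rfl

def liftK {m N : ℕ} (k : Fin m → ZMod N) : Fin m → ℤ := fun i => ((k i).val : ℤ)

def castK {m : ℕ} (N : ℕ) (x : Fin m → ℤ) : Fin m → ZMod N := fun i => (x i : ZMod N)

lemma cast_lift {m N : ℕ} [NeZero N] (k : Fin m → ZMod N) : castK N (liftK k) = k := by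
  ext i; simp [castK, liftK]

lemma castK_add {m N : ℕ} (x y : Fin m → ℤ) : castK N (x + y) = castK N x + castK N y := by
  ext i; simp [castK]

lemma castK_mulVec {m N : ℕ} (A : Matrix (Fin m) (Fin m) ℤ) (x : Fin m → ℤ) :
    castK N (A.mulVec x) = (A.map ((↑) : ℤ → ZMod N)).mulVec (castK N x) := by
  ext i; simp [castK, Matrix.mulVec, dotProduct]

lemma castK_eq {m N : ℕ} (x y : Fin m → ℤ) (h : castK N x = castK N y) : ∃ z, x = y + (N:ℤ) • z := by
  have : ∀ i, ∃ z : ℤ, x i = y i + N * z := by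
    intro i
    have h1 : ((x i : ℤ) : ZMod N) = y i := congrFun h i
    rw [ZMod.intCast_eq_intCast_iff_dvd_sub] at h1
    obtain ⟨z, hz⟩ := h1
    exact ⟨-z, by linarith⟩
  choose z hz using this
  exact ⟨z, by ext i; simp [hz]⟩

lemma per_cast {m N : ℕ} {M : Type*} (F : (Fin m → ℤ) → M) (hF : ∀ x y, F (x + (N:ℤ) • y) = F x)
    {x y : Fin m → ℤ} (h : castK N x = castK N y) : F x = F y := by
  obtain ⟨z, rfl⟩ := castK_eq x y h
  exact hF y z

/-- The sum over the cokernel is proportional to the sum over the box. -/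
lemma sum_T {m : ℕ} (N : ℕ) [NeZero N] {T : Type*} [AddCommGroup T] [Fintype T]
    (j : (Fin m → ℤ) →+ T) (hjsurj : Function.Surjective j)
    (hjN : ∀ y, j ((N:ℤ) • y) = 0) (h : T → ℂ) :
    ∃ c : ℝ, 0 < c ∧ ∑ k : Fin m → ZMod N, h (j (liftK k)) = c * ∑ t, h t := by
  classical
  have hper : ∀ x y, j (x + (N:ℤ) • y) = j x := by intro x y; rw [map_add, hjN, add_zero]
  let π : (Fin m → ZMod N) →+ T := AddMonoidHom.mk' (fun k => j (liftK k)) (by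
    intro a b
    rw [← map_add]
    apply per_cast j hper
    rw [castK_add, cast_lift, cast_lift, cast_lift])
  obtain ⟨c, hc, hs⟩ := sum_hom π h
  refine ⟨c, hc, ?_⟩
  have : Finset.univ.filter (fun t => t ∈ Set.range π) = Finset.univ := by
    ext t
    simp only [Finset.mem_filter, Finset.mem_univ, true_and, iff_true]
    obtain ⟨x, rfl⟩ := hjsurj t
    refine ⟨castK N x, ?_⟩
    exact per_cast j hper (cast_lift _)
  rw [this] at hs
  exact hs

lemma even_conj {m : ℕ} (A B : Matrix (Fin m) (Fin m) ℤ)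
    (heven : ∀ x : Fin m → ℤ, ∃ c : ℤ, x ⬝ᵥ A.mulVec x = 2 * c) :
    ∀ x : Fin m → ℤ, ∃ c : ℤ, x ⬝ᵥ (B.transpose * A * B).mulVec x = 2 * c := by
  intro x
  obtain ⟨c, hc⟩ := heven (B.mulVec x)
  refine ⟨c, ?_⟩
  rw [← hc, Matrix.mul_assoc, ← Matrix.mulVec_mulVec, ← Matrix.mulVec_mulVec, Matrix.dotProduct_mulVec,
    Matrix.vecMul_transpose]

lemma sum_B {m : ℕ} (N : ℕ) [NeZero N] (A B : Matrix (Fin m) (Fin m) ℤ) (hsymm : A.IsSymm) (hdet : A.det ≠ 0)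
    (hB : B.det ≠ 0) (heven : ∀ x : Fin m → ℤ, ∃ c : ℤ, x ⬝ᵥ A.mulVec x = 2 * c)
    (hN : (B.transpose * A * B).det ∣ (N:ℤ)) :
    ∃ c : ℝ, 0 < c ∧ ∑ k : Fin m → ZMod N, Gq A (liftK k) =
      c * ∑ k : Fin m → ZMod N, Gq (B.transpose * A * B) (liftK k) := by
  classical
  have hBN : B.det ∣ (N:ℤ) := by
    refine dvd_trans ?_ hN
    rw [Matrix.det_mul]; exact dvd_mul_left _ _
  have hBN' : B.transpose.det ∣ (N:ℤ) := by rwa [Matrix.det_transpose]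
  have hsymm' : (B.transpose * A * B).IsSymm := by
    rw [Matrix.IsSymm]
    simp [Matrix.transpose_mul, hsymm.eq, Matrix.mul_assoc]
  have hdet' : (B.transpose * A * B).det ≠ 0 := by
    simp only [Matrix.det_mul, Matrix.det_transpose]
    exact mul_ne_zero (mul_ne_zero hB hdet) hB
  have heven' := even_conj A B heven
  have hper := Gq_periodic _ hsymm' hdet' heven' (N:ℤ) hN
  have hXr : ∀ ψ x y, Xc B ψ (x + (N:ℤ) • y) = Xc B ψ x := by
    intro ψ x y
    obtain ⟨z, hz⟩ := exists_pre B N hBN y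
    rw [Xc_add_right, hz, Xc_right B hB, mul_one]
  have hXl : ∀ x ψ y, Xc B (ψ + (N:ℤ) • y) x = Xc B ψ x := by
    intro x ψ y
    obtain ⟨z, hz⟩ := exists_pre B.transpose N hBN' y
    rw [Xc_add_left, hz, Xc_left B hB, mul_one]
  let π : (Fin m → ZMod N) →+ (Fin m → ZMod N) :=
    (Matrix.mulVecLin (B.transpose.map ((↑) : ℤ → ZMod N))).toAddMonoidHom
  have hπ : ∀ k, π k = castK N (B.transpose.mulVec (liftK k)) := by
    intro k
    rw [castK_mulVec, cast_lift]; rfl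
  obtain ⟨c, hc, hs⟩ := sum_hom π (fun k => Gq (B.transpose * A * B) (liftK k))
  refine ⟨c, hc, ?_⟩
  have h1 : ∀ k : Fin m → ZMod N, Gq (B.transpose * A * B) (liftK (π k)) = Gq A (liftK k) := by
    intro k
    rw [← Gq_pull A B hB]
    apply per_cast _ hper
    rw [cast_lift, hπ]
  simp only [h1] at hs
  rw [hs]
  congr 1
  -- orthogonality
  have horth : ∀ k : Fin m → ZMod N, ∑ x : Fin m → ZMod N, Xc B (liftK k) (liftK x) =
      if k ∈ Set.range π then (Fintype.card (Fin m → ZMod N) : ℂ) else 0 := by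
    intro k
    split_ifs with hk
    · obtain ⟨l, rfl⟩ := hk
      have : ∀ x : Fin m → ZMod N, Xc B (liftK (π l)) (liftK x) = 1 := by
        intro x
        rw [← Xc_left B hB (liftK l) (liftK x)]
        apply per_cast (fun ψ => Xc B ψ (liftK x)) (hXl _)
        rw [cast_lift, hπ]
      simp [this]
    · have : ∃ x0, Xc B (liftK k) x0 ≠ 1 := by
        by_contra hcon
        push Not at hcon
        obtain ⟨φ, hφ⟩ := Xc_trivial B hB _ hcon
        apply hk
        refine ⟨castK N φ, ?_⟩
        rw [← cast_lift k, hφ, castK_mulVec]; rfl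
      obtain ⟨x0, hx0⟩ := this
      have e1 : ∑ x : Fin m → ZMod N, Xc B (liftK k) (liftK x) =
          (∑ x : Fin m → ZMod N, Xc B (liftK k) (liftK x)) * Xc B (liftK k) x0 := by
        rw [Finset.sum_mul]
        rw [← Equiv.sum_comp (Equiv.addRight (castK N x0))]
        refine Finset.sum_congr rfl fun x _ => ?_
        rw [← Xc_add_right]
        apply per_cast _ (hXr _)
        rw [cast_lift, castK_add, cast_lift]; rfl
      by_contra hne
      apply hx0
      have : (∑ x : Fin m → ZMod N, Xc B (liftK k) (liftK x)) * 1 =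
          (∑ x : Fin m → ZMod N, Xc B (liftK k) (liftK x)) * Xc B (liftK k) x0 := by rw [mul_one]; exact e1
      exact (mul_left_cancel₀ hne this).symm
  have hcard : (Fintype.card (Fin m → ZMod N) : ℂ) ≠ 0 := by exact_mod_cast Fintype.card_ne_zero
  have h2 : (Fintype.card (Fin m → ZMod N) : ℂ) * ∑ k : Fin m → ZMod N, Gq (B.transpose * A * B) (liftK k)
      = ∑ k : Fin m → ZMod N, Gq (B.transpose * A * B) (liftK k) * ∑ x : Fin m → ZMod N, Xc B (liftK k) (liftK x) := by
    simp only [Finset.mul_sum]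
    rw [← Finset.mul_sum, Finset.sum_comm]
    rw [← nsmul_eq_mul, ← Finset.card_univ, ← Finset.sum_const]
    refine Finset.sum_congr rfl fun x _ => ?_
    rw [← Equiv.sum_comp (Equiv.addRight (castK N ((B.transpose * A).mulVec (liftK x))))]
    refine Finset.sum_congr rfl fun k _ => ?_
    rw [← Gq_shift A B hsymm hdet hB heven]
    apply per_cast _ hper
    rw [cast_lift, castK_add, cast_lift]; rfl
  apply mul_left_cancel₀ hcard
  rw [h2, Finset.sum_filter, Finset.mul_sum]
  refine Finset.sum_congr rfl fun k _ => ?_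
  rw [horth]
  split_ifs <;> ring

lemma Gq_diag {m : ℕ} (e : Fin m → ℤ) (he : ∀ i, e i ≠ 0) (ψ : Fin m → ℤ) :
    Gq (Matrix.diagonal e) ψ = ∏ i, eQ ((ψ i : ℚ)^2 / (2 * e i)) := by
  rw [Gq, ← eQ_sum]
  congr 1
  have h1 : ((Matrix.diagonal e).map ((↑) : ℤ → ℚ))⁻¹ = Matrix.diagonal (fun i => ((e i : ℚ))⁻¹) := by
    apply Matrix.inv_eq_left_inv
    rw [Matrix.diagonal_map (by simp), Matrix.diagonal_mul_diagonal, ← Matrix.diagonal_one]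
    congr 1
    ext i
    exact inv_mul_cancel₀ (by exact_mod_cast he i)
  rw [linv, h1, dotProduct, Finset.sum_div]
  refine Finset.sum_congr rfl fun i _ => ?_
  rw [Matrix.mulVec_diagonal, ratVec]
  have : (e i : ℚ) ≠ 0 := by exact_mod_cast he i
  field_simp

lemma sum_diag {m : ℕ} (N : ℕ) [NeZero N] (e : Fin m → ℤ) (he : ∀ i, e i ≠ 0) :
    ∑ k : Fin m → ZMod N, Gq (Matrix.diagonal e) (liftK k) =
      ∏ i, ∑ r : ZMod N, eQ ((r.val : ℚ)^2 / (2 * e i)) := by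
  rw [Finset.prod_univ_sum]
  simp only [Fintype.piFinset_univ]
  refine Finset.sum_congr rfl fun k _ => ?_
  rw [Gq_diag e he]
  rfl

lemma gauss_signed (d : ℤ) (hd : d ≠ 0) (heven : Even d) (N : ℕ) [NeZero N] (hN : d ∣ (N:ℤ)) :
    ∃ c : ℝ, 0 ≤ c ∧ ∑ r : ZMod N, eQ ((r.val : ℚ)^2 / (2 * d)) = c * eQ ((d.sign : ℚ) / 8) := by
  have key : ∀ d : ℤ, 0 < d → Even d → d ∣ (N:ℤ) →
      ∃ c : ℝ, 0 ≤ c ∧ ∑ r : ZMod N, eQ ((r.val : ℚ)^2 / (2 * d)) = c * eQ (1 / 8) := by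
    intro d hd heven hN
    obtain ⟨c, hc, h⟩ := gauss_one d hd heven N hN
    refine ⟨c, hc, ?_⟩
    have e1 : eQ (1/8) = Complex.exp (2 * Real.pi * Complex.I * (1/8)) := by
      rw [eQ]; push_cast; rfl
    rw [e1, ← h]
    have hdC : (d:ℂ) ≠ 0 := by exact_mod_cast hd.ne'
    have e2 : ∀ n : ℕ, eQ ((n : ℚ)^2 / (2 * d)) = Complex.exp (Real.pi * Complex.I * (n:ℂ)^2 / d) := by
      intro n
      rw [eQ]; congr 1; push_cast; field_simp
    simp only [e2]
    obtain ⟨n, rfl⟩ := Nat.exists_eq_succ_of_ne_zero (NeZero.ne N)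
    rfl
  rcases lt_or_gt_of_ne hd with h | h
  · obtain ⟨c, hc, hs⟩ := key (-d) (by omega) heven.neg (by rwa [neg_dvd])
    refine ⟨c, hc, ?_⟩
    have := congrArg (starRingEnd ℂ) hs
    rw [map_sum, map_mul, Complex.conj_ofReal, eQ_conj] at this
    simp only [eQ_conj] at this
    rw [Int.sign_eq_neg_one_of_neg h]
    convert this using 3
    · congr 1; push_cast
      rw [mul_neg, div_neg, neg_neg]
    · push_cast; ring
  · obtain ⟨c, hc, hs⟩ := key d h heven hN
    refine ⟨c, hc, ?_⟩
    rw [Int.sign_eq_one_of_pos h]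
    rw [Int.cast_one]
    exact hs

lemma sum_sign {m : ℕ} (e : Fin m → ℤ) : ∑ i, (e i).sign =
    ((Finset.univ.filter fun i => 0 < e i).card : ℤ) - ((Finset.univ.filter fun i => e i < 0).card : ℤ) := by
  rw [Finset.card_filter, Finset.card_filter]
  push_cast
  rw [← Finset.sum_sub_distrib]
  refine Finset.sum_congr rfl fun i _ => ?_
  rcases lt_trichotomy (e i) 0 with h | h | h
  · rw [Int.sign_eq_neg_one_of_neg h]; simp [h, not_lt.2 h.le]
  · simp [h]
  · rw [Int.sign_eq_one_of_pos h]; simp [h, not_lt.2 h.le]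

/-- Milgram: for an even nondegenerate symmetric integral form `λ`
with signature `σ(λ)`, the homogeneous quadratic refinement `q_{λ,0}` on
`T = coker λ̂` has Arf invariant `A(q) = σ(λ)/8` in `ℚ/ℤ`, i.e.
`8·A(q) ≡ σ(λ) mod 8`. -/
theorem stmt9 {m : ℕ}
    (A : Matrix (Fin m) (Fin m) ℤ) (hsymm : A.IsSymm) (hdet : A.det ≠ 0)
    (heven : ∀ x : Fin m → ℤ, ∃ c : ℤ, x ⬝ᵥ A.mulVec x = 2 * c)
    (sig : ℤ)
    (hsig : ∃ (P : Matrix (Fin m) (Fin m) ℝ) (d : Fin m → ℝ), IsUnit P.det ∧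
        P * (A.map ((↑) : ℤ → ℝ)) * P.transpose = Matrix.diagonal d ∧
        sig = ((Finset.univ.filter fun i => 0 < d i).card : ℤ) -
            ((Finset.univ.filter fun i => d i < 0).card : ℤ))
    {T : Type*} [AddCommGroup T] [Fintype T]
    (j : (Fin m → ℤ) →+ T) (hjsurj : Function.Surjective j)
    (hjker : ∀ φ : Fin m → ℤ, j φ = 0 ↔ ∃ x : Fin m → ℤ, φ = A.mulVec x)
    (q : T → AddCircle (1 : ℚ))
    (hq : ∀ φ : Fin m → ℤ, q (j φ) =
        ((linv A (ratVec φ) (ratVec φ) / 2 : ℚ) : AddCircle (1 : ℚ)))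
    (Arf : AddCircle (1 : ℚ))
    (hArf : ∑ x : T, eQZ (q x) = Real.sqrt (Fintype.card T) * eQZ Arf) :
    Arf = (((sig : ℚ) / 8 : ℚ) : AddCircle (1 : ℚ)) := by
  obtain ⟨B, e, hB, hdiag⟩ := exists_diag A hsymm
  have hdet' : (B.transpose * A * B).det ≠ 0 := by
    simp only [Matrix.det_mul, Matrix.det_transpose]
    exact mul_ne_zero (mul_ne_zero hB hdet) hB
  have hprod : (B.transpose * A * B).det = ∏ i, e i := by rw [hdiag, Matrix.det_diagonal]
  have he : ∀ i, e i ≠ 0 := by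
    intro i hi
    apply hdet'
    rw [hprod]
    exact Finset.prod_eq_zero (Finset.mem_univ i) hi
  have heE : ∀ i, Even (e i) := by
    intro i
    obtain ⟨c, hc⟩ := even_conj A B heven (Pi.single i 1)
    rw [hdiag] at hc
    simp only [Matrix.mulVec_single_one, single_one_dotProduct, Matrix.col_apply, Matrix.diagonal_apply_eq] at hc
    rw [hc]; exact even_two_mul c
  set N : ℕ := (B.transpose * A * B).det.natAbs with hNdef
  have : NeZero N := ⟨Int.natAbs_ne_zero.2 hdet'⟩
  have hN : (B.transpose * A * B).det ∣ (N:ℤ) := Int.dvd_natAbs.2 dvd_rfl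
  have hAN : A.det ∣ (N:ℤ) := by
    refine dvd_trans ?_ hN
    rw [Matrix.det_mul, Matrix.det_mul]
    exact Dvd.dvd.mul_right (dvd_mul_left _ _) _
  have heN : ∀ i, e i ∣ (N:ℤ) := by
    intro i
    refine dvd_trans ?_ hN
    rw [hprod]
    exact Finset.dvd_prod_of_mem e (Finset.mem_univ i)
  obtain ⟨c1, hc1, h1⟩ := sum_T N j hjsurj (by
    intro y
    rw [hjker]
    exact exists_pre A N hAN y) (fun t => eQZ (q t))
  have h1' : ∀ φ, eQZ (q (j φ)) = Gq A φ := by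
    intro φ
    rw [hq, eQZ_coe, Gq]
  simp only [h1'] at h1
  obtain ⟨c2, hc2, h2⟩ := sum_B N A B hsymm hdet hB heven hN
  rw [hdiag, sum_diag N e he] at h2
  choose c hc0 hc using fun i => gauss_signed (e i) (he i) (heE i) N (heN i)
  simp only [hc] at h2
  rw [Finset.prod_mul_distrib, ← eQ_sum, ← Finset.sum_div] at h2
  have hsg : (∑ i, ((e i).sign : ℚ)) = (sig : ℚ) := by
    have : sig = ∑ i, (e i).sign := by
      obtain ⟨P, d, hP, hPd, hs⟩ := hsig
      rw [hs, sum_sign]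
      have hBR : (B.map ((↑) : ℤ → ℝ)).det = (B.det : ℝ) := ((Int.castRingHom ℝ).map_det B).symm
      have := inertia (A.map ((↑) : ℤ → ℝ)) P (B.map ((↑) : ℤ → ℝ)).transpose d (fun i => (e i : ℝ)) hP
        (by rw [Matrix.det_transpose, hBR, isUnit_iff_ne_zero]; exact_mod_cast hB) hPd (by
          have h := congrArg (fun M : Matrix (Fin m) (Fin m) ℤ => M.map (Int.castRingHom ℝ)) hdiag
          simp only [Matrix.map_mul] at h
          rw [Matrix.diagonal_map (by simp)] at h
          exact h)
      rw [this]
      simp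
    rw [this]; push_cast; rfl
  rw [hsg, h1, hArf] at h2
  induction Arf using QuotientAddGroup.induction_on with
  | H r =>
    refine eQ_ray (c := c1 * Real.sqrt (Fintype.card T)) (c' := c2 * ∏ i, c i) ?_ ?_ ?_
    · have : 0 < (Fintype.card T : ℝ) := by exact_mod_cast Fintype.card_pos
      positivity
    · exact mul_nonneg hc2.le (Finset.prod_nonneg fun i _ => hc0 i)
    · have h3 : eQZ ((r : ℚ) : AddCircle (1:ℚ)) = eQ r := rfl
      push_cast
      rw [mul_assoc, mul_assoc, ← h2]
      rfl
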